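/- There holds the integral identity ∫_{ρ₋}^{ρ₊} ( ẽ₀'(ρ) − (3/4)·G₀'(ρ) )·G₀'(ρ) dρ = 0. -/

import Mathlib

noncomputable section

/-- `Q₀(ρ) = (ρ − ρ₋)√ρ₋ + (ρ₊ − ρ)√ρ₊`. -/
def Q0 (ρm ρp ρ : ℝ) : ℝ := (ρ - ρm) * Real.sqrt ρm + (ρp - ρ) * Real.sqrt ρp

/-- `G₀(ρ) = (ρ₊ − ρ)(ρ − ρ₋)(√ρ₋ − √ρ₊)/Q₀(ρ)`. -/
def G0 (ρm ρp ρ : ℝ) : ℝ :=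
  (ρp - ρ) * (ρ - ρm) * (Real.sqrt ρm - Real.sqrt ρp) / Q0 ρm ρp ρ

/-- `ẽ₀(ρ) = ρ₊ρ₋(ρ₊ − ρ₋)²/(2 Q₀(ρ)²)`. -/
def e0 (ρm ρp ρ : ℝ) : ℝ := ρp * ρm * (ρp - ρm) ^ 2 / (2 * Q0 ρm ρp ρ ^ 2)

theorem Q0_pos {ρm ρp ρ : ℝ} (hρm : 0 < ρm) (hρ : ρm < ρp) (hmem : ρ ∈ Set.Icc ρm ρp) :
    0 < Q0 ρm ρp ρ := by
  have ha := Real.sqrt_pos.2 hρm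
  have hb := Real.sqrt_lt_sqrt hρm.le hρ
  obtain ⟨h₁, h₂⟩ := hmem
  unfold Q0
  nlinarith [mul_nonneg (sub_nonneg.2 h₂) (sub_pos.2 hb).le, mul_pos (sub_pos.2 hρ) ha]

theorem hasDerivAt_Q0 (ρm ρp ρ : ℝ) :
    HasDerivAt (Q0 ρm ρp) (√ρm - √ρp) ρ := by
  have h := (((hasDerivAt_id ρ).sub_const ρm).mul_const √ρm).add
    (((hasDerivAt_id ρ).const_sub ρp).mul_const √ρp)
  exact h.congr_deriv (by ring)

theorem hasDerivAt_Q0_inv_pow {ρm ρp ρ : ℝ} (hQ : Q0 ρm ρp ρ ≠ 0) (n : ℕ) :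
    HasDerivAt (fun x => (Q0 ρm ρp x ^ n)⁻¹)
      (n * (√ρp - √ρm) * (Q0 ρm ρp ρ ^ (n + 1))⁻¹) ρ := by
  refine (((hasDerivAt_Q0 ρm ρp ρ).pow n).inv (pow_ne_zero n hQ)).congr_deriv ?_
  cases n with
  | zero => simp
  | succ n =>
    simp only [Nat.add_sub_cancel, Pi.pow_apply]
    field_simp
    ring

theorem hasDerivAt_e0 {ρm ρp ρ : ℝ} (hQ : Q0 ρm ρp ρ ≠ 0) :
    HasDerivAt (e0 ρm ρp)
      (ρp * ρm * (ρp - ρm) ^ 2 * (√ρp - √ρm) * (Q0 ρm ρp ρ ^ 3)⁻¹) ρ := by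
  have h := (hasDerivAt_Q0_inv_pow hQ 2).const_mul (ρp * ρm * (ρp - ρm) ^ 2 / 2)
  refine (h.congr_deriv (by push_cast; ring)).congr_of_eventuallyEq (.of_forall fun x => ?_)
  simp only [e0, div_eq_mul_inv, mul_inv]
  ring

theorem hasDerivAt_G0 {ρm ρp ρ : ℝ} (hρm : 0 ≤ ρm) (hρp : 0 ≤ ρp) (hQ : Q0 ρm ρp ρ ≠ 0) :
    HasDerivAt (G0 ρm ρp)
      (√ρm * √ρp * (ρp - ρm) ^ 2 * (Q0 ρm ρp ρ ^ 2)⁻¹ - 1) ρ := by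
  have h := ((((hasDerivAt_id ρ).const_sub ρp).mul ((hasDerivAt_id ρ).sub_const ρm)).mul_const
    (√ρm - √ρp)).div (hasDerivAt_Q0 ρm ρp ρ) hQ
  refine h.congr_deriv ?_
  have ha := Real.sq_sqrt hρm
  have hb := Real.sq_sqrt hρp
  simp only [id, Pi.mul_apply]
  field_simp
  unfold Q0
  generalize √ρm = a at *
  generalize √ρp = b at *
  subst ha hb
  ring

/-- `∫_{ρ₋}^{ρ₊} (ẽ₀'(ρ) − (3/4)G₀'(ρ))·G₀'(ρ) dρ = 0`. -/
theorem unperturbed_energy_identity (ρm ρp : ℝ) (hρm : 0 < ρm) (hρ : ρm < ρp) :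
    ∫ ρ in ρm..ρp,
      (deriv (e0 ρm ρp) ρ - (3 / 4) * deriv (G0 ρm ρp) ρ) * deriv (G0 ρm ρp) ρ = 0 := by
  have hρp := hρm.trans hρ
  have ha := Real.sqrt_pos.2 hρm
  have hab := Real.sqrt_lt_sqrt hρm.le hρ
  have hb := ha.trans hab
  have hQ : ∀ x ∈ Set.uIcc ρm ρp, Q0 ρm ρp x ≠ 0 := fun x hx =>
    (Q0_pos hρm hρ (Set.uIcc_of_le hρ.le ▸ hx)).ne'
  have hcont : Continuous (Q0 ρm ρp) := by unfold Q0; fun_prop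
  set d := √ρp - √ρm with hd
  have hd0 : d ≠ 0 := (sub_pos.2 hab).ne'
  set k := √ρm * √ρp * (ρp - ρm) ^ 2 with hk
  set K := ρp * ρm * (ρp - ρm) ^ 2 with hK
  have hcongr : Set.EqOn
      (fun x => (deriv (e0 ρm ρp) x - (3 / 4) * deriv (G0 ρm ρp) x) * deriv (G0 ρm ρp) x)
      (fun x => (K * d * (Q0 ρm ρp x ^ 3)⁻¹ - (3 / 4) * (k * (Q0 ρm ρp x ^ 2)⁻¹ - 1)) *
        (k * (Q0 ρm ρp x ^ 2)⁻¹ - 1)) (Set.uIcc ρm ρp) := fun x hx => by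
    simp only [(hasDerivAt_e0 (hQ x hx)).deriv,
      (hasDerivAt_G0 hρm.le hρp.le (hQ x hx)).deriv, hd, hk, hK]
  have hprim : ∀ x ∈ Set.uIcc ρm ρp, HasDerivAt
      (fun x => K * k / 4 * (Q0 ρm ρp x ^ 4)⁻¹ - K / 2 * (Q0 ρm ρp x ^ 2)⁻¹
        - k ^ 2 / (4 * d) * (Q0 ρm ρp x ^ 3)⁻¹ + 3 * k / (2 * d) * (Q0 ρm ρp x ^ 1)⁻¹
        - 3 / 4 * x)
      ((K * d * (Q0 ρm ρp x ^ 3)⁻¹ - (3 / 4) * (k * (Q0 ρm ρp x ^ 2)⁻¹ - 1)) *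
        (k * (Q0 ρm ρp x ^ 2)⁻¹ - 1)) x := fun x hx => by
    have hx := hQ x hx
    have h := (((((hasDerivAt_Q0_inv_pow hx 4).const_mul (K * k / 4)).sub
      ((hasDerivAt_Q0_inv_pow hx 2).const_mul (K / 2))).sub
      ((hasDerivAt_Q0_inv_pow hx 3).const_mul (k ^ 2 / (4 * d)))).add
      ((hasDerivAt_Q0_inv_pow hx 1).const_mul (3 * k / (2 * d)))).sub
      ((hasDerivAt_id x).const_mul (3 / 4))
    refine h.congr_deriv ?_
    rw [← hd]
    push_cast
    field_simp
    ring
  rw [intervalIntegral.integral_congr hcongr,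
    intervalIntegral.integral_eq_sub_of_hasDerivAt hprim]
  · have hQm : Q0 ρm ρp ρm = (ρp - ρm) * √ρp := by simp [Q0]
    have hQp : Q0 ρm ρp ρp = (ρp - ρm) * √ρm := by simp [Q0]
    have hs : ρp - ρm = d * (√ρp + √ρm) := by
      rw [hd]
      linear_combination Real.sq_sqrt hρm.le - Real.sq_sqrt hρp.le
    have hs0 : ρp - ρm ≠ 0 := (sub_pos.2 hρ).ne'
    have hK' : K = √ρp ^ 2 * √ρm ^ 2 * (ρp - ρm) ^ 2 := by
      rw [Real.sq_sqrt hρm.le, Real.sq_sqrt hρp.le]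
    simp only [hQm, hQp, hK', hk]
    field_simp
    rw [hd] at hs ⊢
    rw [hs]
    linear_combination 6 * √ρm * √ρp * (√ρm - √ρp) * hs
  · apply ContinuousOn.intervalIntegrable
    have hinv (n : ℕ) : ContinuousOn (fun x => (Q0 ρm ρp x ^ n)⁻¹) (Set.uIcc ρm ρp) :=
      (hcont.pow n).continuousOn.inv₀ fun x hx => pow_ne_zero n (hQ x hx)
    have h₂ := hinv 2
    have h₃ := hinv 3
    fun_prop
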